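/- Let U ⊂ ℝⁿ×ℝⁿ×ℝ be open and g ∈ C²(U) with ∂_z g ≠ 0 on U, and let E = g_{xy} − (g_z)^{−1} g_{xz} ⊗ g_y be the associated matrix field. Fix x ∈ ℝⁿ and u ∈ ℝ, let V ⊂ ℝⁿ be open, and let Y : V → ℝⁿ, Z : V → ℝ be differentiable maps with (x, Y(p), Z(p)) ∈ U, g(x, Y(p), Z(p)) = u and ∇_x g(x, Y(p), Z(p)) = p for all p ∈ V. Then E(x, Y(p), Z(p)) · D_pY(p) = Iₙ for every p ∈ V; in particular E(x, Y(p), Z(p)) is invertible and D_pY(p) = E(x, Y(p), Z(p))^{−1}. -/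

import Mathlib

/-- Partial derivative of `g(x,y,z)` in the coordinate `x i`. -/
noncomputable def pdX {n : ℕ} (g : (Fin n → ℝ) → (Fin n → ℝ) → ℝ → ℝ)
    (i : Fin n) (x y : Fin n → ℝ) (z : ℝ) : ℝ :=
  deriv (fun s => g (Function.update x i s) y z) (x i)

/-- Partial derivative of `g(x,y,z)` in the coordinate `y j`. -/
noncomputable def pdY {n : ℕ} (g : (Fin n → ℝ) → (Fin n → ℝ) → ℝ → ℝ)
    (j : Fin n) (x y : Fin n → ℝ) (z : ℝ) : ℝ :=
  deriv (fun s => g x (Function.update y j s) z) (y j)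

/-- Partial derivative of `g(x,y,z)` in `z`. -/
noncomputable def pdZ {n : ℕ} (g : (Fin n → ℝ) → (Fin n → ℝ) → ℝ → ℝ)
    (x y : Fin n → ℝ) (z : ℝ) : ℝ :=
  deriv (fun s => g x y s) z

/-- Partial derivative in the coordinate `x i` of a function of `x` alone. -/
noncomputable def pdU {n : ℕ} (u : (Fin n → ℝ) → ℝ) (i : Fin n) (x : Fin n → ℝ) : ℝ :=
  deriv (fun s => u (Function.update x i s)) (x i)

/-- The matrix `E = g_{xy} − (g_z)⁻¹ g_{xz} ⊗ g_y` associated with a generating function. -/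
noncomputable def Emat {n : ℕ} (g : (Fin n → ℝ) → (Fin n → ℝ) → ℝ → ℝ)
    (x y : Fin n → ℝ) (z : ℝ) : Matrix (Fin n) (Fin n) ℝ :=
  Matrix.of fun i j =>
    pdX (fun x' y' z' => pdY g j x' y' z') i x y z -
      (pdZ g x y z)⁻¹ * pdX (fun x' y' z' => pdZ g x' y' z') i x y z * pdY g j x y z

section PartialDerivatives

variable {n : ℕ} {g : (Fin n → ℝ) → (Fin n → ℝ) → ℝ → ℝ} {x y : Fin n → ℝ} {z : ℝ}
  {L : (Fin n → ℝ) × (Fin n → ℝ) × ℝ →L[ℝ] ℝ}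

theorem pdX_eq_of_hasFDerivAt
    (h : HasFDerivAt (fun w : (Fin n → ℝ) × (Fin n → ℝ) × ℝ => g w.1 w.2.1 w.2.2) L (x, y, z))
    (i : Fin n) : pdX g i x y z = L (Pi.single i 1, 0, 0) := by
  have hc : HasDerivAt (fun s => (Function.update x i s, y, z)) (Pi.single i (1 : ℝ), 0, 0) (x i) :=
    (hasDerivAt_update x i (x i)).prodMk (hasDerivAt_const (x i) (y, z))
  exact (h.comp_hasDerivAt_of_eq (x i) hc (by simp)).deriv

theorem pdY_eq_of_hasFDerivAt
    (h : HasFDerivAt (fun w : (Fin n → ℝ) × (Fin n → ℝ) × ℝ => g w.1 w.2.1 w.2.2) L (x, y, z))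
    (j : Fin n) : pdY g j x y z = L (0, Pi.single j 1, 0) := by
  have hc : HasDerivAt (fun s => (x, Function.update y j s, z)) (0, Pi.single j (1 : ℝ), 0) (y j) :=
    (hasDerivAt_const (y j) x).prodMk
      ((hasDerivAt_update y j (y j)).prodMk (hasDerivAt_const (y j) z))
  exact (h.comp_hasDerivAt_of_eq (y j) hc (by simp)).deriv

theorem pdZ_eq_of_hasFDerivAt
    (h : HasFDerivAt (fun w : (Fin n → ℝ) × (Fin n → ℝ) × ℝ => g w.1 w.2.1 w.2.2) L (x, y, z)) :
    pdZ g x y z = L (0, 0, 1) := by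
  have hc : HasDerivAt (fun s => (x, y, s)) (0, 0, (1 : ℝ)) z :=
    (hasDerivAt_const z x).prodMk ((hasDerivAt_const z y).prodMk (hasDerivAt_id z))
  exact (h.comp_hasDerivAt_of_eq z hc rfl).deriv

theorem pdU_eq_of_hasFDerivAt {f : (Fin n → ℝ) → ℝ} {A : (Fin n → ℝ) →L[ℝ] ℝ}
    (h : HasFDerivAt f A x) (i : Fin n) : pdU f i x = A (Pi.single i 1) :=
  (h.comp_hasDerivAt_of_eq (x i) (hasDerivAt_update x i (x i)) (by simp)).deriv

theorem map_zero_prodMk_eq_sum (L : (Fin n → ℝ) × (Fin n → ℝ) × ℝ →L[ℝ] ℝ)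
    (v : Fin n → ℝ) (t : ℝ) :
    L (0, v, t) = ∑ k, L (0, Pi.single k 1, 0) * v k + L (0, 0, 1) * t := by
  have hv : ((0 : Fin n → ℝ), v, t) =
      ∑ k, v k • ((0 : Fin n → ℝ), (Pi.single k 1 : Fin n → ℝ), (0 : ℝ)) +
        t • ((0 : Fin n → ℝ), (0 : Fin n → ℝ), (1 : ℝ)) := by
    ext k <;> simp [Prod.fst_sum, Prod.snd_sum, Finset.sum_apply, Pi.single_apply]
  rw [hv]
  simp only [map_add, map_sum, map_smul, smul_eq_mul, mul_comm]

/-- At a point of twice continuous differentiability, `E` is expressed by the first and second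
Fréchet derivatives of the generating function. -/
theorem Emat_apply_eq_fderiv
    (h : ContDiffAt ℝ 2 (fun w : (Fin n → ℝ) × (Fin n → ℝ) × ℝ => g w.1 w.2.1 w.2.2) (x, y, z))
    (i j : Fin n) :
    let G := fun w : (Fin n → ℝ) × (Fin n → ℝ) × ℝ => g w.1 w.2.1 w.2.2
    Emat g x y z i j =
      fderiv ℝ (fderiv ℝ G) (x, y, z) (0, Pi.single j 1, 0) (Pi.single i 1, 0, 0) -
        (fderiv ℝ G (x, y, z) (0, 0, 1))⁻¹ *
          fderiv ℝ (fderiv ℝ G) (x, y, z) (0, 0, 1) (Pi.single i 1, 0, 0) *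
          fderiv ℝ G (x, y, z) (0, Pi.single j 1, 0) := by
  intro G
  have hdiff : ∀ᶠ w in nhds (x, y, z), HasFDerivAt G (fderiv ℝ G w) w := by
    filter_upwards [h.eventually (by simp)] with w hw
    exact (hw.differentiableAt (by simp)).hasFDerivAt
  have hd2 : HasFDerivAt (fderiv ℝ G) (fderiv ℝ (fderiv ℝ G) (x, y, z)) (x, y, z) :=
    ((h.fderiv_right (m := 1) (by norm_num)).differentiableAt (by simp)).hasFDerivAt
  have hsymm : IsSymmSndFDerivAt ℝ G (x, y, z) := h.isSymmSndFDerivAt (by simp)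
  have happly (v : (Fin n → ℝ) × (Fin n → ℝ) × ℝ) :=
    hd2.clm_apply (hasFDerivAt_const v (x, y, z))
  have hxy := pdX_eq_of_hasFDerivAt (g := pdY g j)
    ((happly (0, Pi.single j 1, 0)).congr_of_eventuallyEq
      (hdiff.mono fun w hw => pdY_eq_of_hasFDerivAt hw j)) i
  have hxz := pdX_eq_of_hasFDerivAt (g := pdZ g)
    ((happly (0, 0, 1)).congr_of_eventuallyEq
      (hdiff.mono fun w hw => pdZ_eq_of_hasFDerivAt hw)) i
  have hy := pdY_eq_of_hasFDerivAt hdiff.self_of_nhds j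
  have hz := pdZ_eq_of_hasFDerivAt hdiff.self_of_nhds
  simp only [Emat, Matrix.of_apply, hxy, hxz, hy, hz]
  rw [hsymm.eq (0, Pi.single j 1, 0), hsymm.eq (0, 0, 1)]
  simp [G]

end PartialDerivatives

/-- Differentiating the generating relations `g(x, Y(p), Z(p)) = u`,
`g_x(x, Y(p), Z(p)) = p` with respect to `p` gives `E · D_pY = I`, so `E` is
invertible with `D_pY = E⁻¹`. -/
theorem Yp_eq_Emat_inv {n : ℕ}
    (U : Set ((Fin n → ℝ) × (Fin n → ℝ) × ℝ)) (hU : IsOpen U)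
    (g : (Fin n → ℝ) → (Fin n → ℝ) → ℝ → ℝ)
    (hg : ContDiffOn ℝ 2 (fun w : (Fin n → ℝ) × (Fin n → ℝ) × ℝ => g w.1 w.2.1 w.2.2) U)
    (hgz : ∀ w ∈ U, pdZ g w.1 w.2.1 w.2.2 ≠ 0)
    (x : Fin n → ℝ) (u : ℝ)
    (V : Set (Fin n → ℝ)) (hV : IsOpen V)
    (Y : (Fin n → ℝ) → (Fin n → ℝ)) (Z : (Fin n → ℝ) → ℝ)
    (hY : ∀ p ∈ V, DifferentiableAt ℝ Y p)
    (hZ : ∀ p ∈ V, DifferentiableAt ℝ Z p)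
    (hmem : ∀ p ∈ V, (x, Y p, Z p) ∈ U)
    (hval : ∀ p ∈ V, g x (Y p) (Z p) = u)
    (hgrad : ∀ p ∈ V, ∀ i, pdX g i x (Y p) (Z p) = p i) :
    ∀ p ∈ V,
      Emat g x (Y p) (Z p) * (Matrix.of fun k j => pdU (fun p' => Y p' k) j p) = 1
      ∧ IsUnit (Emat g x (Y p) (Z p))
      ∧ (Matrix.of fun k j => pdU (fun p' => Y p' k) j p) = (Emat g x (Y p) (Z p))⁻¹ := by
  intro p hp
  set G := fun w : (Fin n → ℝ) × (Fin n → ℝ) × ℝ => g w.1 w.2.1 w.2.2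
  set P : (Fin n → ℝ) → (Fin n → ℝ) × (Fin n → ℝ) × ℝ := fun q => (x, Y q, Z q)
  have hcd (q) (hq : q ∈ V) : ContDiffAt ℝ 2 G (P q) := hg.contDiffAt (hU.mem_nhds (hmem q hq))
  have hd1 (q) (hq : q ∈ V) : HasFDerivAt G (fderiv ℝ G (P q)) (P q) :=
    ((hcd q hq).differentiableAt (by simp)).hasFDerivAt
  have hd2 : HasFDerivAt (fderiv ℝ G) (fderiv ℝ (fderiv ℝ G) (P p)) (P p) :=
    (((hcd p hp).fderiv_right (m := 1) (by norm_num)).differentiableAt (by simp)).hasFDerivAt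
  have hY' := (hY p hp).hasFDerivAt
  have hP := (hasFDerivAt_const x p).prodMk (hY'.prodMk (hZ p hp).hasFDerivAt)
  have hVp := hV.mem_nhds hp
  have hvalue (q : Fin n → ℝ) :
      fderiv ℝ G (P p) (0, fderiv ℝ Y p q, fderiv ℝ Z p q) = 0 := by
    have hconst : HasFDerivAt (G ∘ P) (0 : (Fin n → ℝ) →L[ℝ] ℝ) p :=
      (hasFDerivAt_const u p).congr_of_eventuallyEq (Filter.mem_of_superset hVp hval)
    exact DFunLike.congr_fun (((hd1 p hp).comp p hP).unique hconst) q
  have hgradient (i : Fin n) (q : Fin n → ℝ) :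
      fderiv ℝ (fderiv ℝ G) (P p) (0, fderiv ℝ Y p q, fderiv ℝ Z p q)
        (Pi.single i 1, 0, 0) = q i := by
    have hproj : HasFDerivAt (fun q => fderiv ℝ G (P q) (Pi.single i 1, 0, 0))
        (ContinuousLinearMap.proj (R := ℝ) (φ := fun _ : Fin n => ℝ) i) p :=
      (ContinuousLinearMap.proj (R := ℝ) (φ := fun _ : Fin n => ℝ) i).hasFDerivAt
        |>.congr_of_eventuallyEq (Filter.mem_of_superset hVp fun q hq =>
          (pdX_eq_of_hasFDerivAt (hd1 q hq) i).symm.trans (hgrad q hq i))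
    have hcomp := (hd2.comp p hP).clm_apply (hasFDerivAt_const (Pi.single i (1 : ℝ), 0, 0) p)
    simpa using DFunLike.congr_fun (hcomp.unique hproj) q
  have hmul : Emat g x (Y p) (Z p) * (Matrix.of fun k j => pdU (fun p' => Y p' k) j p) = 1 := by
    ext i j
    have hzne : fderiv ℝ G (P p) (0, 0, 1) ≠ 0 :=
      pdZ_eq_of_hasFDerivAt (hd1 p hp) ▸ hgz _ (hmem p hp)
    have hYk (k : Fin n) : pdU (fun p' => Y p' k) j p = fderiv ℝ Y p (Pi.single j 1) k :=
      pdU_eq_of_hasFDerivAt (hasFDerivAt_pi'.1 hY' k) j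
    have hE (k : Fin n) : Emat g x (Y p) (Z p) i k =
        fderiv ℝ (fderiv ℝ G) (P p) (0, Pi.single k 1, 0) (Pi.single i 1, 0, 0) -
          (fderiv ℝ G (P p) (0, 0, 1))⁻¹ *
            fderiv ℝ (fderiv ℝ G) (P p) (0, 0, 1) (Pi.single i 1, 0, 0) *
            fderiv ℝ G (P p) (0, Pi.single k 1, 0) := Emat_apply_eq_fderiv (hcd p hp) i k
    have hval_j := hvalue (Pi.single j 1)
    rw [map_zero_prodMk_eq_sum] at hval_j
    have hgrad_ij := map_zero_prodMk_eq_sum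
      ((fderiv ℝ (fderiv ℝ G) (P p)).flip (Pi.single i 1, 0, 0))
      (fderiv ℝ Y p (Pi.single j 1)) (fderiv ℝ Z p (Pi.single j 1))
    simp only [ContinuousLinearMap.flip_apply] at hgrad_ij
    rw [hgradient] at hgrad_ij
    have hone : (1 : Matrix (Fin n) (Fin n) ℝ) i j = (Pi.single j 1 : Fin n → ℝ) i := by
      simp [Matrix.one_apply, Pi.single_apply]
    rw [Matrix.mul_apply, hone, hgrad_ij]
    simp only [Matrix.of_apply, hYk, hE, sub_mul,
      Finset.sum_sub_distrib, mul_assoc, ← Finset.mul_sum]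
    rw [eq_neg_of_add_eq_zero_left hval_j]
    field_simp
    ring
  exact ⟨hmul, .of_mul_eq_one _ hmul, (Matrix.inv_eq_right_inv hmul).symm⟩
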